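/- Let m ≥ 2 and suppose P, P' ∈ ℝ[X] satisfy P·D_m = Q_m and P'·D_{m+1} = Q_{m+1}. Then P has exactly r_m distinct real roots λ_{m,1} < … < λ_{m,r_m} and P' has exactly r_{m+1} = 2r_m + 2 distinct real roots λ_{m+1,1} < … < λ_{m+1,r_{m+1}}, and these satisfy: 0 < λ_{m+1,1} < φ₋(λ_{m,1}); φ₋(λ_{m,k−1}) < λ_{m+1,k} < φ₋(λ_{m,k}) for all 2 ≤ k ≤ r_m; φ₋(λ_{m,r_m}) < λ_{m+1,r_m+1} < φ₊(λ_{m,r_m}); φ₊(λ_{m,2r_m+2−k}) < λ_{m+1,k} < φ₊(λ_{m,2r_m+1−k}) for all r_m+2 ≤ k ≤ 2r_m; φ₊(λ_{m,1}) < λ_{m+1,2r_m+1} < 5; and 5 < λ_{m+1,2r_m+2} < 6. -/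

import Mathlib

open Function

noncomputable section

/-- The polynomial map `f(x) = x(5-x)`. -/
def f (x : ℝ) : ℝ := x * (5 - x)

/-- `l(x) = x - 6`. -/
def lf (x : ℝ) : ℝ := x - 6

/-- `s(x) = (2-x)(4-x)(5-x) - (14-3x)`. -/
def sf (x : ℝ) : ℝ := (2 - x) * (4 - x) * (5 - x) - (14 - 3 * x)

/-- `r(x) = -2(2-x)(5-x)`. -/
def rf (x : ℝ) : ℝ := -2 * (2 - x) * (5 - x)

/-- The decreasing inverse branch of `f`. -/
def phim (x : ℝ) : ℝ := (5 - Real.sqrt (25 - 4 * x)) / 2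

/-- The increasing inverse branch of `f`. -/
def phip (x : ℝ) : ℝ := (5 + Real.sqrt (25 - 4 * x)) / 2

/-- `q m` is the function `q_m` from the paper, meaningful for `m ≥ 2`
(the values at `m = 0, 1` are junk values `1`, never used in the statements). -/
def q : ℕ → ℝ → ℝ
  | 0, _ => 1
  | 1, _ => 1
  | 2, x => sf x
  | 3, x => sf (f x) * sf x - rf (f x) * lf x
  | m + 4, x =>
      sf (f^[m + 2] x) * q (m + 3) x - rf (f^[m + 2] x) * lf (f^[m + 1] x) * q (m + 2) x

open Polynomial

/-- The polynomial `F = 5X - X²`. -/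
def F : ℝ[X] := C 5 * X - X ^ 2

/-- `Fiter i` is the `i`-fold composition `F^{(i)}`, with `Fiter 0 = X`. -/
def Fiter : ℕ → ℝ[X]
  | 0 => X
  | i + 1 => F.comp (Fiter i)

/-- Polynomial version of `l`. -/
def Lp : ℝ[X] := X - C 6

/-- Polynomial version of `s`. -/
def Sp : ℝ[X] := (C 2 - X) * (C 4 - X) * (C 5 - X) - (C 14 - C 3 * X)

/-- Polynomial version of `r`. -/
def Rp : ℝ[X] := -C 2 * (C 2 - X) * (C 5 - X)

/-- `Qp m` is the polynomial `Q_m`, satisfying `(Qp m).eval x = q_m x`,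
defined by the same recursion as `q_m`; meaningful for `m ≥ 2`. -/
def Qp : ℕ → ℝ[X]
  | 0 => 1
  | 1 => 1
  | 2 => Sp
  | 3 => Sp.comp (Fiter 1) * Sp - Rp.comp (Fiter 1) * Lp
  | m + 4 =>
      Sp.comp (Fiter (m + 2)) * Qp (m + 3) -
        Rp.comp (Fiter (m + 2)) * Lp.comp (Fiter (m + 1)) * Qp (m + 2)

/-- `Dp m = ∏_{i=0}^{m-3} (F^{(i)} - 2)`, with `Dp 2 = 1`. -/
def Dp (m : ℕ) : ℝ[X] := ∏ i ∈ Finset.range (m - 2), (Fiter i - C 2)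

/-- `r_m = 2^m + 2^{m-2} - 2`. -/
def rm (m : ℕ) : ℕ := 2 ^ m + 2 ^ (m - 2) - 2

open Finset in
/-- A polynomial of degree at most `n` with `n` distinct roots is the product of its linear
factors. -/
lemma eval_eq_mul_prod_of_roots {p : ℝ[X]} (hp : p ≠ 0) {n : ℕ} (hn : p.natDegree ≤ n)
    {lam : ℕ → ℝ} (hmono : StrictMonoOn lam (Set.Icc 1 n))
    (hroot : ∀ k, 1 ≤ k → k ≤ n → p.eval (lam k) = 0) :
    ∃ c : ℝ, c ≠ 0 ∧ ∀ x, p.eval x = c * ∏ k ∈ Icc 1 n, (lam k - x) := by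
  have hinj : Set.InjOn lam (Icc 1 n : Finset ℕ) := by
    rw [coe_Icc]
    exact hmono.injOn
  have hle : (Icc 1 n).val.map lam ≤ p.roots := by
    rw [Multiset.le_iff_subset]
    · intro x hx
      obtain ⟨k, hk, rfl⟩ := Multiset.mem_map.1 hx
      have hk' := mem_Icc.1 (mem_def.2 hk)
      exact (mem_roots hp).2 (hroot k hk'.1 hk'.2)
    · exact Multiset.Nodup.map_on (fun a ha b hb h => hinj ha hb h) (Icc 1 n).nodup
  have hcard : ((Icc 1 n).val.map lam).card = n := by simp
  have hroots : (Icc 1 n).val.map lam = p.roots :=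
    Multiset.eq_of_le_of_card_le hle ((card_roots' p).trans (hn.trans hcard.ge))
  have hdeg : p.roots.card = p.natDegree := by
    refine le_antisymm (card_roots' p) ?_
    rw [← hroots, hcard]
    exact hn
  have hfac := C_leadingCoeff_mul_prod_multiset_X_sub_C hdeg
  refine ⟨p.leadingCoeff * (-1) ^ n, by simpa using hp, fun x => ?_⟩
  conv_lhs => rw [← hfac, ← hroots]
  have hprod : (Multiset.map (fun a => X - C a) (Multiset.map lam (Icc 1 n).val)).prod
      = ∏ k ∈ Icc 1 n, (X - C (lam k)) := by
    rw [Multiset.map_map]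
    rfl
  have hneg : ∏ k ∈ Icc 1 n, (x - lam k) = (-1) ^ n * ∏ k ∈ Icc 1 n, (lam k - x) := by
    rw [← prod_congr rfl fun k _ => neg_sub (lam k) x, prod_neg]
    simp
  rw [hprod, eval_mul, eval_C, eval_prod]
  simp only [eval_sub, eval_X, eval_C]
  rw [hneg, mul_assoc]

open Finset in
/-- The sign of a polynomial with a full set of simple real roots, between consecutive roots. -/
lemma sign_between_roots {p : ℝ[X]} {n : ℕ} (hn : p.natDegree ≤ n)
    {lam : ℕ → ℝ} (hmono : StrictMonoOn lam (Set.Icc 1 n))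
    (hroot : ∀ k, 1 ≤ k → k ≤ n → p.eval (lam k) = 0)
    {a : ℝ} (ha : ∀ k, 1 ≤ k → k ≤ n → a < lam k) (hpa : 0 < p.eval a)
    {j : ℕ} (hj : j ≤ n) {x : ℝ} (hlo : 1 ≤ j → lam j < x) (hhi : j < n → x < lam (j + 1)) :
    0 < (-1) ^ j * p.eval x := by
  have hp : p ≠ 0 := by
    rintro rfl
    simp at hpa
  obtain ⟨c, -, hc⟩ := eval_eq_mul_prod_of_roots hp hn hmono hroot
  have hcpos : 0 < c := by
    rw [hc] at hpa
    refine pos_of_mul_pos_left hpa (prod_nonneg fun k hk => ?_)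
    have := ha k (mem_Icc.1 hk).1 (mem_Icc.1 hk).2
    linarith
  have hsign : ((-1 : ℝ)) ^ j = ∏ k ∈ Icc 1 n, if k ≤ j then (-1 : ℝ) else 1 := by
    rw [← prod_filter, prod_const]
    congr 1
    have : (Icc 1 n).filter (fun k => k ≤ j) = Icc 1 j := by
      ext k
      simp only [mem_filter, mem_Icc]
      omega
    simp [this]
  rw [hc, mul_left_comm, hsign, ← prod_mul_distrib]
  refine mul_pos hcpos (prod_pos fun k hk => ?_)
  obtain ⟨hk1, hkn⟩ := mem_Icc.1 hk
  split_ifs with h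
  · have h1 := hmono.monotoneOn ⟨hk1, hkn⟩ ⟨hk1.trans h, hj⟩ h
    have h2 := hlo (hk1.trans h)
    linarith
  · have h1 := hmono.monotoneOn (a := j + 1) ⟨by omega, by omega⟩ ⟨hk1, hkn⟩ (by omega)
    have h2 := hhi (by omega)
    linarith

/-- A polynomial of degree at most `n` alternating in sign along `n + 1` increasing points has
exactly one root in each of the `n` gaps, and no others. -/
lemma exists_roots_of_alternating {p : ℝ[X]} {n : ℕ} (hn : p.natDegree ≤ n) {mu : ℕ → ℝ}
    (hmu : ∀ k < n, mu k < mu (k + 1)) (hsign : ∀ k ≤ n, 0 < (-1) ^ k * p.eval (mu k)) :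
    ∃ lam : ℕ → ℝ, StrictMonoOn lam (Set.Icc 1 n) ∧
      (∀ x : ℝ, p.eval x = 0 ↔ ∃ k : ℕ, 1 ≤ k ∧ k ≤ n ∧ lam k = x) ∧
      ∀ k, 1 ≤ k → k ≤ n → mu (k - 1) < lam k ∧ lam k < mu k := by
  have hp : p ≠ 0 := by
    rintro rfl
    simpa using hsign 0 (Nat.zero_le n)
  have hex : ∀ k, ∃ y, k < n → (mu k < y ∧ y < mu (k + 1)) ∧ p.eval y = 0 := by
    intro k
    by_cases hk : k < n
    · have h0 := hsign k hk.le
      have h1 := hsign (k + 1) hk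
      have hcont : ContinuousOn (fun y => (-1) ^ k * p.eval y) (Set.Icc (mu k) (mu (k + 1))) :=
        (continuous_const.mul p.continuous).continuousOn
      have h1' : (-1) ^ k * p.eval (mu (k + 1)) < 0 := by
        rw [pow_succ] at h1
        linarith
      obtain ⟨y, hy, hy0⟩ := intermediate_value_Ioo' (hmu k hk).le hcont ⟨h1', h0⟩
      exact ⟨y, fun _ => ⟨hy, by simpa using hy0⟩⟩
    · exact ⟨0, fun h => absurd h hk⟩
  choose y hy using hex
  have hmu_le : ∀ a d, a + d ≤ n → mu a ≤ mu (a + d) := by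
    intro a d
    induction d with
    | zero => simp
    | succ d ih => exact fun h => (ih (by omega)).trans (hmu (a + d) (by omega)).le
  have hgap : ∀ k, 1 ≤ k → k ≤ n →
      (mu (k - 1) < y (k - 1) ∧ y (k - 1) < mu k) ∧ p.eval (y (k - 1)) = 0 := by
    intro k hk1 hkn
    have := hy (k - 1) (by omega)
    rwa [Nat.sub_add_cancel hk1] at this
  have hmono : StrictMonoOn (fun k => y (k - 1)) (Set.Icc 1 n) := by
    intro a ha b hb hab
    have h1 := (hgap a ha.1 ha.2).1.2
    have h2 := (hgap b hb.1 hb.2).1.1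
    have h3 := hmu_le a (b - 1 - a) (by have := hb.2; omega)
    rw [show a + (b - 1 - a) = b - 1 by omega] at h3
    exact h1.trans_le (h3.trans h2.le)
  refine ⟨fun k => y (k - 1), hmono, fun x => ⟨fun hx => ?_, ?_⟩,
    fun k hk1 hkn => (hgap k hk1 hkn).1⟩
  · obtain ⟨c, hc0, hc⟩ := eval_eq_mul_prod_of_roots hp hn hmono
      fun k hk1 hkn => (hgap k hk1 hkn).2
    rw [hc, mul_eq_zero, or_iff_right hc0, Finset.prod_eq_zero_iff] at hx
    obtain ⟨k, hk, hk0⟩ := hx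
    exact ⟨k, (Finset.mem_Icc.1 hk).1, (Finset.mem_Icc.1 hk).2, sub_eq_zero.1 hk0⟩
  · rintro ⟨k, hk1, hkn, rfl⟩
    exact (hgap k hk1 hkn).2

section InverseBranches

variable {a : ℝ}

lemma phim_add_phip (a : ℝ) : phim a + phip a = 5 := by
  unfold phim phip
  ring

lemma phim_mul_phip (ha : a ≤ 25 / 4) : phim a * phip a = a := by
  have h := Real.sq_sqrt (show 0 ≤ 25 - 4 * a by linarith)
  unfold phim phip
  linear_combination -h / 4

lemma f_sub_eq (ha : a ≤ 25 / 4) (x : ℝ) : f x - a = (x - phim a) * (phip a - x) := by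
  unfold f
  linear_combination x * -phim_add_phip a + phim_mul_phip ha

lemma phim_lt_phip (ha : a < 25 / 4) : phim a < phip a := by
  have h := Real.sqrt_pos.2 (show 0 < 25 - 4 * a by linarith)
  unfold phim phip
  linarith

lemma f_phim (ha : a ≤ 25 / 4) : f (phim a) = a := by
  have := f_sub_eq ha (phim a)
  rw [sub_self, zero_mul] at this
  linarith

lemma f_phip (ha : a ≤ 25 / 4) : f (phip a) = a := by
  have := f_sub_eq ha (phip a)
  rw [sub_self, mul_zero] at this
  linarith

lemma lt_f (ha : a ≤ 25 / 4) {x : ℝ} (h1 : phim a < x) (h2 : x < phip a) : a < f x := by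
  have := f_sub_eq ha x
  have := mul_pos (sub_pos.2 h1) (sub_pos.2 h2)
  linarith

lemma f_lt_of_lt_phim (ha : a < 25 / 4) {x : ℝ} (h : x < phim a) : f x < a := by
  have := f_sub_eq ha.le x
  have := mul_pos (sub_pos.2 h) (sub_pos.2 (h.trans (phim_lt_phip ha)))
  linarith

lemma f_lt_of_phip_lt (ha : a < 25 / 4) {x : ℝ} (h : phip a < x) : f x < a := by
  have := f_sub_eq ha.le x
  have := mul_pos (sub_pos.2 h) (sub_pos.2 ((phim_lt_phip ha).trans h))
  linarith

lemma phim_lt_phim {b : ℝ} (hab : a < b) (hb : b ≤ 25 / 4) : phim a < phim b := by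
  have := Real.sqrt_lt_sqrt (show 0 ≤ 25 - 4 * b by linarith)
    (show 25 - 4 * b < 25 - 4 * a by linarith)
  unfold phim
  linarith

lemma phip_lt_phip {b : ℝ} (hab : a < b) (hb : b ≤ 25 / 4) : phip b < phip a := by
  have := phim_add_phip a
  have := phim_add_phip b
  have := phim_lt_phim hab hb
  linarith

lemma phim_zero : phim 0 = 0 := by
  unfold phim
  rw [show (25 - 4 * 0 : ℝ) = 5 ^ 2 by norm_num, Real.sqrt_sq (by norm_num)]
  norm_num

lemma phim_six : phim 6 = 2 := by
  unfold phim
  norm_num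

end InverseBranches

lemma eval_F (x : ℝ) : F.eval x = f x := by
  simp [F, f]
  ring

lemma eval_Sp (x : ℝ) : Sp.eval x = sf x := by
  simp [Sp, sf]

lemma Fiter_succ_eq_comp (i : ℕ) : Fiter (i + 1) = (Fiter i).comp F := by
  induction i with
  | zero => simp [Fiter]
  | succ i ih => rw [Fiter, ih, ← Polynomial.comp_assoc, ← Fiter, ← ih]

/-- The defining recursion of `Qp`, which also holds when started from `Qp 1 = 1`. -/
lemma Qp_add_three (k : ℕ) : Qp (k + 3) = Sp.comp (Fiter (k + 1)) * Qp (k + 2) -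
    Rp.comp (Fiter (k + 1)) * Lp.comp (Fiter k) * Qp (k + 1) := by
  cases k with
  | zero => simp [Qp, Fiter]
  | succ k => rw [Qp]

/-- Expansion of the continuant `Qp` from the other end. -/
lemma Qp_add_three_eq_comp (k : ℕ) : Qp (k + 3) = Sp * (Qp (k + 2)).comp F -
    Rp.comp F * Lp * ((Qp (k + 1)).comp F).comp F := by
  induction k using Nat.twoStepInduction with
  | zero => simp [Qp, Fiter, mul_comm]
  | one =>
    simp only [Qp, Fiter, comp_X, sub_comp, mul_comp, Polynomial.comp_assoc]
    ring
  | more k ih0 ih1 =>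
    have e1 := congrArg (fun p => p.comp F) (Qp_add_three (k + 1))
    have e0 := congrArg (fun p => (p.comp F).comp F) (Qp_add_three k)
    have h := Qp_add_three (k + 2)
    simp only [sub_comp, mul_comp, Polynomial.comp_assoc Sp,
      Polynomial.comp_assoc Rp, Polynomial.comp_assoc Lp,
      ← Fiter_succ_eq_comp] at e0 e1
    rw [show k + 2 + 3 = k + 5 from rfl, show k + 2 + 2 = k + 4 from rfl,
      show k + 2 + 1 = k + 3 from rfl] at h ⊢
    rw [show k + 1 + 3 = k + 4 from rfl, show k + 1 + 2 = k + 3 from rfl,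
      show k + 1 + 1 = k + 2 from rfl] at e1 ih1
    rw [show k + 1 + 1 = k + 2 from rfl, show k + 1 + 1 + 1 = k + 3 from rfl] at e0
    rw [h, e1, e0, ih1, ih0]
    ring

lemma Dp_succ {m : ℕ} (hm : 2 ≤ m) : Dp (m + 1) = (X - C 2) * (Dp m).comp F := by
  obtain ⟨n, rfl⟩ := Nat.exists_eq_add_of_le' hm
  simp only [Dp, show n + 2 + 1 - 2 = n + 1 by omega, Nat.add_sub_cancel]
  rw [Finset.prod_range_succ', Polynomial.prod_comp, mul_comm]
  simp only [Fiter_succ_eq_comp, sub_comp, C_comp]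
  rw [Fiter]

lemma F_natDegree : F.natDegree = 2 := by
  unfold F
  compute_degree!

lemma Dp_ne_zero {m : ℕ} (hm : 2 ≤ m) : Dp m ≠ 0 := by
  induction m, hm using Nat.le_induction with
  | base => simp [Dp]
  | succ m hm ih =>
    rw [Dp_succ hm]
    refine mul_ne_zero (X_sub_C_ne_zero 2) fun h => ?_
    rw [Polynomial.comp_eq_zero_iff] at h
    rcases h with h | ⟨-, h⟩
    · exact ih h
    · have := congrArg natDegree h
      rw [F_natDegree, natDegree_C] at this
      omega

lemma rm_succ {m : ℕ} (hm : 2 ≤ m) : rm (m + 1) = 2 * rm m + 2 := by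
  obtain ⟨n, rfl⟩ := Nat.exists_eq_add_of_le' hm
  have := Nat.one_le_two_pow (n := n)
  simp only [rm, show n + 2 + 1 - 2 = n + 1 by omega, Nat.add_sub_cancel, pow_succ]
  omega

/-- Data attached to a list `lam 1 < … < lam n` of roots of `p`: `p` has degree at most
`n`, and the auxiliary polynomial `g` alternates in sign along the roots, up to the factor
`5 - lam k`. -/
structure RootData (n : ℕ) (p g : ℝ[X]) (lam : ℕ → ℝ) : Prop where
  one_le : 1 ≤ n
  natDegree_p : p.natDegree ≤ n
  natDegree_g : g.natDegree ≤ n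
  mono : StrictMonoOn lam (Set.Icc 1 n)
  root_iff : ∀ x : ℝ, p.eval x = 0 ↔ ∃ k : ℕ, 1 ≤ k ∧ k ≤ n ∧ lam k = x
  pos : ∀ k, 1 ≤ k → k ≤ n → 0 < lam k
  lt_six : ∀ k, 1 ≤ k → k ≤ n → lam k < 6
  sign_g : ∀ k, 1 ≤ k → k ≤ n → 0 < (-1) ^ (k - 1) * ((5 - lam k) * g.eval (lam k))
  g_zero : 0 < g.eval 0
  p_zero : 10 * g.eval 0 < p.eval 0
  eval_six : p.eval 6 = g.eval 6

/-- The points separating the roots at one level, built from the roots at the previous level. -/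
def breakpoint (n : ℕ) (lam : ℕ → ℝ) (k : ℕ) : ℝ :=
  if k = 0 then 0 else if k ≤ n then phim (lam k) else
    if k ≤ 2 * n then phip (lam (2 * n + 1 - k)) else if k = 2 * n + 1 then 5 else 6

section Breakpoint

variable {n k : ℕ} {lam : ℕ → ℝ}

lemma breakpoint_zero : breakpoint n lam 0 = 0 := by simp [breakpoint]

lemma breakpoint_of_le (h1 : 1 ≤ k) (h2 : k ≤ n) : breakpoint n lam k = phim (lam k) := by
  rw [breakpoint, if_neg (by omega), if_pos h2]

lemma breakpoint_of_lt (h1 : n < k) (h2 : k ≤ 2 * n) :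
    breakpoint n lam k = phip (lam (2 * n + 1 - k)) := by
  rw [breakpoint, if_neg (by omega), if_neg (by omega), if_pos h2]

lemma breakpoint_five (h : 1 ≤ n) : breakpoint n lam (2 * n + 1) = 5 := by
  rw [breakpoint, if_neg (by omega), if_neg (by omega), if_neg (by omega), if_pos rfl]

lemma breakpoint_six (h : 1 ≤ n) : breakpoint n lam (2 * n + 2) = 6 := by
  rw [breakpoint, if_neg (by omega), if_neg (by omega), if_neg (by omega), if_neg (by omega)]

end Breakpoint

namespace RootData

variable {n : ℕ} {p g : ℝ[X]} {lam : ℕ → ℝ}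

lemma lt_top (h : RootData n p g lam) {k : ℕ} (h1 : 1 ≤ k) (h2 : k ≤ n) : lam k < 25 / 4 := by
  have := h.lt_six k h1 h2
  linarith

lemma p_zero_pos (h : RootData n p g lam) : 0 < p.eval 0 := by
  linarith [h.g_zero, h.p_zero]

lemma sign_p (h : RootData n p g lam) {j : ℕ} (hj : j ≤ n) {x : ℝ} (hlo : 1 ≤ j → lam j < x)
    (hhi : j < n → x < lam (j + 1)) : 0 < (-1) ^ j * p.eval x :=
  sign_between_roots h.natDegree_p h.mono (fun k h1 h2 => (h.root_iff _).2 ⟨k, h1, h2, rfl⟩)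
    h.pos h.p_zero_pos hj hlo hhi

lemma sign_p_of_neg (h : RootData n p g lam) {x : ℝ} (hx : x ≤ 0) : 0 < p.eval x := by
  simpa using h.sign_p (Nat.zero_le n) (by omega) fun _ => hx.trans_lt (h.pos 1 le_rfl h.one_le)

lemma phim_pos (h : RootData n p g lam) {k : ℕ} (h1 : 1 ≤ k) (h2 : k ≤ n) : 0 < phim (lam k) := by
  rw [← phim_zero]
  exact phim_lt_phim (h.pos k h1 h2) (h.lt_top h1 h2).le

lemma phim_lt_two (h : RootData n p g lam) {k : ℕ} (h1 : 1 ≤ k) (h2 : k ≤ n) :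
    phim (lam k) < 2 := by
  rw [← phim_six]
  exact phim_lt_phim (h.lt_six k h1 h2) (by norm_num)

lemma breakpoint_lt (h : RootData n p g lam) {k : ℕ} (hk : k < 2 * n + 2) :
    breakpoint n lam k < breakpoint n lam (k + 1) := by
  have hn := h.one_le
  rcases Nat.eq_zero_or_pos k with rfl | hk0
  · rw [breakpoint_zero, breakpoint_of_le (by omega) (by omega)]
    exact h.phim_pos (by omega) (by omega)
  rcases lt_trichotomy k n with hkn | rfl | hkn
  · rw [breakpoint_of_le hk0 hkn.le, breakpoint_of_le (by omega) (by omega)]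
    exact phim_lt_phim (h.mono ⟨hk0, hkn.le⟩ ⟨by omega, by omega⟩ (by omega))
      (h.lt_top (by omega) (by omega)).le
  · rw [breakpoint_of_le hk0 le_rfl, breakpoint_of_lt (by omega) (by omega),
      show 2 * k + 1 - (k + 1) = k by omega]
    exact phim_lt_phip (h.lt_top hk0 le_rfl)
  rcases lt_trichotomy k (2 * n) with hk2 | rfl | hk2
  · rw [breakpoint_of_lt hkn hk2.le, breakpoint_of_lt (by omega) (by omega)]
    exact phip_lt_phip (h.mono ⟨by omega, by omega⟩ ⟨by omega, by omega⟩ (by omega))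
      (h.lt_top (by omega) (by omega)).le
  · rw [breakpoint_of_lt hkn le_rfl, breakpoint_five hn, show 2 * n + 1 - 2 * n = 1 by omega]
    linarith [phim_add_phip (lam 1), h.phim_pos le_rfl hn]
  · obtain rfl : k = 2 * n + 1 := by omega
    rw [breakpoint_five hn, breakpoint_six hn]
    norm_num

/-- Existence of the quotient polynomial at the next level. -/
lemma exists_next (h : RootData n p g lam) : ∃ p' : ℝ[X], (C 2 - X) * p' =
    Sp * p.comp F + C 2 * (C 5 - F) * Lp * g.comp F := by
  have hroot : (Sp * p.comp F + C 2 * (C 5 - F) * Lp * g.comp F).IsRoot 2 := by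
    simp only [IsRoot, eval_add, eval_mul, eval_comp, eval_sub, eval_C, eval_F, eval_Sp, Lp, eval_X]
    rw [show f 2 = 6 by norm_num [f], h.eval_six]
    norm_num [sf]
  obtain ⟨t, ht⟩ := dvd_iff_isRoot.2 hroot
  exact ⟨-t, by rw [ht]; ring⟩

variable {p' : ℝ[X]}

lemma eval_next (hp' : (C 2 - X) * p' = Sp * p.comp F + C 2 * (C 5 - F) * Lp * g.comp F) (x : ℝ) :
    (2 - x) * p'.eval x =
      sf x * p.eval (f x) + 2 * (5 - f x) * (x - 6) * g.eval (f x) := by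
  have := congrArg (Polynomial.eval x) hp'
  simpa [eval_comp, eval_F, eval_Sp, Lp] using this

lemma natDegree_next (h : RootData n p g lam)
    (hp' : (C 2 - X) * p' = Sp * p.comp F + C 2 * (C 5 - F) * Lp * g.comp F) :
    p'.natDegree ≤ 2 * n + 2 := by
  rcases eq_or_ne p' 0 with rfl | h0
  · simp
  have hlin : (C 2 - X : ℝ[X]).natDegree = 1 := by compute_degree!
  have hlin0 : (C 2 - X : ℝ[X]) ≠ 0 := fun h => by simp [h] at hlin
  have hS : Sp.natDegree ≤ 3 := by unfold Sp; compute_degree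
  have hL : (C 2 * (C 5 - F) * Lp).natDegree ≤ 3 := by unfold F Lp; compute_degree
  have e : ((C 2 - X) * p').natDegree ≤ 2 * n + 3 := by
    rw [hp']
    refine natDegree_add_le_of_degree_le (natDegree_mul_le.trans ?_) (natDegree_mul_le.trans ?_)
    · rw [natDegree_comp, F_natDegree]
      have := h.natDegree_p
      omega
    · rw [natDegree_comp, F_natDegree]
      have := h.natDegree_g
      omega
  rw [natDegree_mul hlin0 h0, hlin] at e
  omega

lemma sign_next_breakpoint (h : RootData n p g lam)
    (hp' : (C 2 - X) * p' = Sp * p.comp F + C 2 * (C 5 - F) * Lp * g.comp F)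
    {k : ℕ} (hk : k ≤ 2 * n + 2) : 0 < (-1) ^ k * p'.eval (breakpoint n lam k) := by
  have hn := h.one_le
  have hz : ∀ j, 1 ≤ j → j ≤ n → ∀ y, f y = lam j →
      (2 - y) * p'.eval y = 2 * (5 - lam j) * (y - 6) * g.eval (lam j) := by
    intro j h1 h2 y hy
    rw [eval_next hp', hy, (h.root_iff _).2 ⟨j, h1, h2, rfl⟩]
    ring
  rcases Nat.eq_zero_or_pos k with rfl | hk0
  · rw [breakpoint_zero]
    have := eval_next hp' 0
    norm_num [f, sf] at this ⊢
    linarith [h.p_zero, h.g_zero]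
  rcases le_or_gt k n with hkn | hkn
  · rw [breakpoint_of_le hk0 hkn]
    have h2 := h.phim_lt_two hk0 hkn
    have e := hz k hk0 hkn _ (f_phim (h.lt_top hk0 hkn).le)
    have hg := h.sign_g k hk0 hkn
    obtain ⟨i, rfl⟩ : ∃ i, k = i + 1 := ⟨k - 1, by omega⟩
    rw [Nat.add_sub_cancel] at hg
    refine pos_of_mul_pos_right (a := 2 - phim (lam (i + 1))) ?_ (by linarith)
    have : 0 < (6 - phim (lam (i + 1))) * ((-1) ^ i * ((5 - lam (i + 1)) * g.eval (lam (i + 1)))) :=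
      mul_pos (by linarith) hg
    rw [mul_left_comm, e, pow_succ]
    linarith
  rcases le_or_gt k (2 * n) with hk2 | hk2
  · rw [breakpoint_of_lt hkn hk2]
    obtain ⟨i, hi, rfl⟩ : ∃ i, i < n ∧ k = 2 * n - i := ⟨2 * n - k, by omega, by omega⟩
    rw [show 2 * n + 1 - (2 * n - i) = i + 1 by omega]
    have hi1 : 1 ≤ i + 1 := by omega
    have h2 := h.phim_lt_two hi1 hi
    have h0 := h.phim_pos hi1 hi
    have hs := phim_add_phip (lam (i + 1))
    have e := hz (i + 1) hi1 hi _ (f_phip (h.lt_top hi1 hi).le)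
    have hg := h.sign_g (i + 1) hi1 hi
    rw [Nat.add_sub_cancel] at hg
    have hpow : (-1 : ℝ) ^ (2 * n - i) = (-1) ^ i := by
      rw [neg_one_pow_eq_pow_mod_two, neg_one_pow_eq_pow_mod_two (n := i)]
      congr 1
      omega
    rw [hpow]
    refine pos_of_mul_pos_right (a := phip (lam (i + 1)) - 2) ?_ (by linarith)
    have : 0 < (6 - phip (lam (i + 1))) * ((-1) ^ i * ((5 - lam (i + 1)) * g.eval (lam (i + 1)))) :=
      mul_pos (by linarith) hg
    rw [mul_left_comm, ← neg_sub 2 (phip _), neg_mul, e]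
    linarith
  rcases (show k = 2 * n + 1 ∨ k = 2 * n + 2 by omega) with rfl | rfl
  · rw [breakpoint_five hn, pow_succ, pow_mul]
    have := eval_next hp' 5
    norm_num [f, sf] at this ⊢
    linarith [h.p_zero]
  · rw [breakpoint_six hn, show 2 * n + 2 = 2 * (n + 1) by ring, pow_mul]
    have := eval_next hp' 6
    have hpos := h.sign_p_of_neg (x := -6) (by norm_num)
    norm_num [f, sf] at this ⊢
    linarith

/-- The signs of `p ∘ f` at points in the gaps between consecutive breakpoints. -/
lemma sign_comp_of_mem_gap (h : RootData n p g lam) {k : ℕ} (hk1 : 1 ≤ k) (hk2 : k ≤ 2 * n + 2)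
    {x : ℝ} (hlo : breakpoint n lam (k - 1) < x) (hhi : x < breakpoint n lam k) :
    0 < (-1) ^ (k - 1) * ((5 - x) * p.eval (f x)) := by
  have hn := h.one_le
  have hle : ∀ a d, a + d ≤ 2 * n + 2 → breakpoint n lam a ≤ breakpoint n lam (a + d) := by
    intro a d
    induction d with
    | zero => simp
    | succ d ih => exact fun hd => (ih (by omega)).trans (h.breakpoint_lt (by omega)).le
  rcases eq_or_ne k (2 * n + 2) with rfl | hk3
  · rw [show 2 * n + 2 - 1 = 2 * n + 1 by omega] at hlo ⊢
    rw [breakpoint_five hn] at hlo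
    rw [breakpoint_six hn] at hhi
    have hf : f x ≤ 0 := by
      unfold f
      nlinarith
    have := mul_pos (sub_pos.2 hlo) (h.sign_p_of_neg hf)
    rw [pow_succ, pow_mul]
    norm_num
    linarith
  have hx5 : x < 5 := by
    have := hle k (2 * n + 1 - k) (by omega)
    rw [show k + (2 * n + 1 - k) = 2 * n + 1 by omega, breakpoint_five hn] at this
    linarith
  rw [mul_left_comm]
  refine mul_pos (by linarith) ?_
  rcases le_or_gt k (n + 1) with hkn | hkn
  · refine h.sign_p (by omega) (fun hj => ?_) (fun hj => ?_)
    · rw [breakpoint_of_le hj (by omega)] at hlo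
      refine lt_f (h.lt_top hj (by omega)).le hlo ?_
      have := hle k (2 * n + 1 - (k - 1) - k) (by omega)
      rw [show k + (2 * n + 1 - (k - 1) - k) = 2 * n + 1 - (k - 1) by omega,
        breakpoint_of_lt (k := 2 * n + 1 - (k - 1)) (by omega) (by omega),
        show 2 * n + 1 - (2 * n + 1 - (k - 1)) = k - 1 by omega] at this
      linarith
    · rw [Nat.sub_add_cancel hk1]
      rw [breakpoint_of_le hk1 (by omega)] at hhi
      exact f_lt_of_lt_phim (h.lt_top hk1 (by omega)) hhi
  · obtain ⟨j, hj, rfl⟩ : ∃ j, j < n ∧ k = 2 * n + 1 - j := ⟨2 * n + 1 - k, by omega, by omega⟩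
    have hpow : (-1 : ℝ) ^ (2 * n + 1 - j - 1) = (-1) ^ j := by
      rw [neg_one_pow_eq_pow_mod_two, neg_one_pow_eq_pow_mod_two (n := j)]
      congr 1
      omega
    rw [hpow]
    refine h.sign_p hj.le (fun hj1 => ?_) (fun _ => ?_)
    · rw [breakpoint_of_lt (by omega) (by omega),
        show 2 * n + 1 - (2 * n + 1 - j) = j by omega] at hhi
      refine lt_f (h.lt_top hj1 hj.le).le ?_ hhi
      have := hle j (2 * n + 1 - j - 1 - j) (by omega)
      rw [show j + (2 * n + 1 - j - 1 - j) = 2 * n + 1 - j - 1 by omega,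
        breakpoint_of_le hj1 hj.le] at this
      linarith
    · rw [breakpoint_of_lt (by omega) (by omega),
        show 2 * n + 1 - (2 * n + 1 - j - 1) = j + 1 by omega] at hlo
      exact f_lt_of_phip_lt (h.lt_top (by omega) hj) hlo

/-- Passing to the next level: the new roots lie one in each gap between the breakpoints. -/
lemma exists_next_roots (h : RootData n p g lam)
    (hp' : (C 2 - X) * p' = Sp * p.comp F + C 2 * (C 5 - F) * Lp * g.comp F) :
    ∃ lam' : ℕ → ℝ, RootData (2 * n + 2) p' (p.comp F) lam' ∧
      ∀ k, 1 ≤ k → k ≤ 2 * n + 2 →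
        breakpoint n lam (k - 1) < lam' k ∧ lam' k < breakpoint n lam k := by
  have hn := h.one_le
  obtain ⟨lam', hmono, hroot, hgap⟩ := exists_roots_of_alternating
    (mu := breakpoint n lam) (h.natDegree_next hp')
    (fun k hk => h.breakpoint_lt hk) (fun k hk => h.sign_next_breakpoint hp' hk)
  have hfirst := (hgap 1 le_rfl (by omega)).1
  have hlast := (hgap (2 * n + 2) (by omega) le_rfl).2
  rw [Nat.sub_self, breakpoint_zero] at hfirst
  rw [breakpoint_six hn] at hlast
  have h0 : f 0 = 0 := by norm_num [f]
  refine ⟨lam', ⟨by omega, h.natDegree_next hp', ?_, hmono, hroot, fun k h1 h2 => ?_,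
    fun k h1 h2 => ?_, fun k h1 h2 => ?_, ?_, ?_, ?_⟩, hgap⟩
  · rw [natDegree_comp, F_natDegree]
    have := h.natDegree_p
    omega
  · exact hfirst.trans_le (hmono.monotoneOn ⟨le_rfl, by omega⟩ ⟨h1, h2⟩ h1)
  · exact (hmono.monotoneOn ⟨h1, h2⟩ ⟨by omega, le_rfl⟩ h2).trans_lt hlast
  · rw [eval_comp, eval_F]
    exact h.sign_comp_of_mem_gap h1 h2 (hgap k h1 h2).1 (hgap k h1 h2).2
  · rw [eval_comp, eval_F, h0]
    exact h.p_zero_pos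
  · have := eval_next hp' 0
    rw [eval_comp, eval_F, h0]
    norm_num [h0, sf] at this
    linarith [h.p_zero]
  · have := eval_next hp' 6
    rw [eval_comp, eval_F]
    norm_num [sf] at this
    linarith

end RootData

lemma exists_rootData_Sp : ∃ lam : ℕ → ℝ, RootData 3 Sp (C 2 - X) lam := by
  let mu : ℕ → ℝ := fun k => if k = 0 then 0 else if k = 1 then 2 else if k = 2 then 5 else 6
  have hdeg : Sp.natDegree ≤ 3 := by unfold Sp; compute_degree
  obtain ⟨lam, hmono, hroot, hgap⟩ := exists_roots_of_alternating (mu := mu) hdeg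
    (fun k hk => by interval_cases k <;> norm_num [mu])
    (fun k hk => by interval_cases k <;> norm_num [mu, eval_Sp, sf])
  have h1 := hgap 1 (by norm_num) (by norm_num)
  have h2 := hgap 2 (by norm_num) (by norm_num)
  have h3 := hgap 3 (by norm_num) (by norm_num)
  norm_num [mu] at h1 h2 h3
  refine ⟨lam, ⟨by norm_num, hdeg, by compute_degree!, hmono, hroot, fun k hk1 hk2 => ?_,
    fun k hk1 hk2 => ?_, fun k hk1 hk2 => ?_, ?_, ?_, ?_⟩⟩
  · interval_cases k <;> linarith
  · interval_cases k <;> linarith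
  · interval_cases k <;> simp <;> nlinarith
  all_goals norm_num [eval_Sp, sf]

/-- The recursion for the quotients `p = ±Qp / Dp`, read off from that of `Qp`. -/
lemma next_mul_Dp {m : ℕ} (hm : 2 ≤ m) {p g p' : ℝ[X]} (hpD : p * Dp m = (-1) ^ m * Qp m)
    (hgD : g * Dp m = (-1) ^ m * ((C 2 - X) * (Qp (m - 1)).comp F))
    (hp' : (C 2 - X) * p' = Sp * p.comp F + C 2 * (C 5 - F) * Lp * g.comp F) :
    p' * Dp (m + 1) = (-1) ^ (m + 1) * Qp (m + 1) := by
  have hpF := congrArg (fun t => t.comp F) hpD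
  have hgF := congrArg (fun t => t.comp F) hgD
  obtain ⟨k, rfl⟩ := Nat.exists_eq_add_of_le' hm
  simp only [show k + 2 - 1 = k + 1 by omega, mul_comp, pow_comp, neg_comp, one_comp, sub_comp,
    C_comp, X_comp] at hpF hgF
  have hR : Rp.comp F = -C 2 * (C 2 - F) * (C 5 - F) := by simp [Rp]
  rw [Dp_succ hm, Qp_add_three_eq_comp, hR, pow_succ]
  linear_combination -(Dp (k + 2)).comp F * hp' - Sp * hpF - C 2 * (C 5 - F) * Lp * hgF

lemma exists_rootData {m : ℕ} (hm : 2 ≤ m) : ∃ (p g : ℝ[X]) (lam : ℕ → ℝ),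
    RootData (rm m) p g lam ∧ p * Dp m = (-1) ^ m * Qp m ∧
      g * Dp m = (-1) ^ m * ((C 2 - X) * (Qp (m - 1)).comp F) := by
  induction m, hm using Nat.le_induction with
  | base =>
    obtain ⟨lam, h⟩ := exists_rootData_Sp
    exact ⟨Sp, C 2 - X, lam, h, by simp [Dp, Qp], by simp [Dp, Qp]⟩
  | succ m hm ih =>
    obtain ⟨p, g, lam, h, hpD, hgD⟩ := ih
    obtain ⟨p', hp'⟩ := h.exists_next
    obtain ⟨lam', h', -⟩ := h.exists_next_roots hp'
    rw [← rm_succ hm] at h'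
    refine ⟨p', p.comp F, lam', h', next_mul_Dp hm hpD hgD hp', ?_⟩
    have hpF := congrArg (fun t => t.comp F) hpD
    simp only [mul_comp, pow_comp, neg_comp, one_comp] at hpF
    rw [Dp_succ hm, Nat.add_sub_cancel, pow_succ]
    linear_combination (X - C 2) * hpF

lemma eval_eq_zero_iff_of_mul_Dp_eq {m : ℕ} (hm : 2 ≤ m) {P p : ℝ[X]} (hP : P * Dp m = Qp m)
    (hp : p * Dp m = (-1) ^ m * Qp m) (x : ℝ) : P.eval x = 0 ↔ p.eval x = 0 := by
  have : p = (-1) ^ m * P := by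
    refine mul_right_cancel₀ (Dp_ne_zero hm) ?_
    rw [hp, mul_assoc, hP]
  simp [this]

theorem statement_6 (m : ℕ) (hm : 2 ≤ m) (P P' : ℝ[X])
    (hP : P * Dp m = Qp m) (hP' : P' * Dp (m + 1) = Qp (m + 1)) :
    ∃ lam lam' : ℕ → ℝ,
      StrictMonoOn lam (Set.Icc 1 (rm m)) ∧
      (∀ x : ℝ, P.eval x = 0 ↔ ∃ k : ℕ, 1 ≤ k ∧ k ≤ rm m ∧ lam k = x) ∧
      StrictMonoOn lam' (Set.Icc 1 (rm (m + 1))) ∧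
      (∀ x : ℝ, P'.eval x = 0 ↔ ∃ k : ℕ, 1 ≤ k ∧ k ≤ rm (m + 1) ∧ lam' k = x) ∧
      rm (m + 1) = 2 * rm m + 2 ∧
      (0 < lam' 1 ∧ lam' 1 < phim (lam 1)) ∧
      (∀ k : ℕ, 2 ≤ k → k ≤ rm m →
        phim (lam (k - 1)) < lam' k ∧ lam' k < phim (lam k)) ∧
      (phim (lam (rm m)) < lam' (rm m + 1) ∧ lam' (rm m + 1) < phip (lam (rm m))) ∧
      (∀ k : ℕ, rm m + 2 ≤ k → k ≤ 2 * rm m →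
        phip (lam (2 * rm m + 2 - k)) < lam' k ∧ lam' k < phip (lam (2 * rm m + 1 - k))) ∧
      (phip (lam 1) < lam' (2 * rm m + 1) ∧ lam' (2 * rm m + 1) < 5) ∧
      (5 < lam' (2 * rm m + 2) ∧ lam' (2 * rm m + 2) < 6) := by
  obtain ⟨p, g, lam, h, hpD, hgD⟩ := exists_rootData hm
  obtain ⟨p', hp'⟩ := h.exists_next
  obtain ⟨lam', h', hgap⟩ := h.exists_next_roots hp'
  have hn := h.one_le
  have hp'D := next_mul_Dp hm hpD hgD hp'
  rw [rm_succ hm]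
  refine ⟨lam, lam', h.mono, fun x => ?_, h'.mono, fun x => ?_, rfl, ?_, fun k h1 h2 => ?_, ?_,
    fun k h1 h2 => ?_, ?_, ?_⟩
  · rw [eval_eq_zero_iff_of_mul_Dp_eq hm hP hpD, h.root_iff]
  · rw [eval_eq_zero_iff_of_mul_Dp_eq (by omega) hP' hp'D, h'.root_iff]
  · simpa [breakpoint_zero, breakpoint_of_le le_rfl hn] using hgap 1 le_rfl (by omega)
  · have := hgap k (by omega) (by omega)
    rwa [breakpoint_of_le (by omega) (by omega), breakpoint_of_le (by omega) h2] at this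
  · have := hgap (rm m + 1) (by omega) (by omega)
    rwa [Nat.add_sub_cancel, breakpoint_of_le hn le_rfl, breakpoint_of_lt (by omega) (by omega),
      show 2 * rm m + 1 - (rm m + 1) = rm m by omega] at this
  · have := hgap k (by omega) (by omega)
    rwa [breakpoint_of_lt (by omega) (by omega), breakpoint_of_lt (by omega) h2,
      show 2 * rm m + 1 - (k - 1) = 2 * rm m + 2 - k by omega] at this
  · have := hgap (2 * rm m + 1) (by omega) (by omega)
    rwa [Nat.add_sub_cancel, breakpoint_of_lt (by omega) le_rfl, breakpoint_five hn,
      show 2 * rm m + 1 - 2 * rm m = 1 by omega] at this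
  · have := hgap (2 * rm m + 2) (by omega) le_rfl
    rwa [show 2 * rm m + 2 - 1 = 2 * rm m + 1 by omega, breakpoint_five hn,
      breakpoint_six hn] at this
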